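/- Assume the metric g on U = (−ε,ε)³ is I-invariant. Let D := {(u,v) : u² + v² < 1}, D⁺ := D ∩ {v ≥ 0} and δ₀ := D ∩ {v = 0}. Let X = (x₁,x₂,x₃) : D⁺ → U be C² up to δ₀, with X(δ₀) contained in the axis {x₂ = x₃ = 0} and ∂_uX ≠ 0 on δ₀ ∖ {(0,0)}, satisfying on D⁺ the conformality relations g(∂_uX,∂_uX) = g(∂_vX,∂_vX) and g(∂_uX,∂_vX) = 0, and the harmonic map system ∂_{uu}x_j + ∂_{vv}x_j + Σ_{k,l=1}^3 Γ^j_{kl}(X) (∂_u x_k ∂_u x_l + ∂_v x_k ∂_v x_l) = 0 for j = 1,2,3. Define Z : D → U by Z := X on D⁺ and Z(u,v) := I(X(u,−v)) for v < 0. Then Z is C² on D and satisfies on all of D the conformality relations g(∂_uZ,∂_uZ) = g(∂_vZ,∂_vZ), g(∂_uZ,∂_vZ) = 0 and the harmonic map system ∂_{uu}z_j + ∂_{vv}z_j + Σ_{k,l=1}^3 Γ^j_{kl}(Z) (∂_u z_k ∂_u z_l + ∂_v z_k ∂_v z_l) = 0 for j = 1,2,3. -/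

import Mathlib

open Set Matrix

noncomputable section

/-- Points of `ℝ³`. -/
abbrev Pt3 := Fin 3 → ℝ

/-- The open cube `U = (−ε,ε)³`. -/
def Ucube (ε : ℝ) : Set Pt3 := {x | ∀ i, |x i| < ε}

/-- The signs `σ₁ = 1`, `σ₂ = σ₃ = −1` of the reflection. -/
def sg : Fin 3 → ℝ := ![1, -1, -1]

/-- The reflection `I(x₁,x₂,x₃) = (x₁,−x₂,−x₃)` about the axis `{x₂ = x₃ = 0}`. -/
def refl3 (x : Pt3) : Pt3 := fun i => sg i * x i

/-- `g` is a smooth Riemannian metric on `U = (−ε,ε)³`: a smooth field of symmetric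
positive-definite matrices. -/
def SmoothMetric (ε : ℝ) (g : Pt3 → Matrix (Fin 3) (Fin 3) ℝ) : Prop :=
  (∀ i j, ContDiffOn ℝ (⊤ : ℕ∞) (fun x => g x i j) (Ucube ε)) ∧
    ∀ x ∈ Ucube ε, (g x).PosDef

/-- `g` is invariant under the reflection `I`: `g_{ij}(I x) = σ_i σ_j g_{ij}(x)`. -/
def IInvariant (ε : ℝ) (g : Pt3 → Matrix (Fin 3) (Fin 3) ℝ) : Prop :=
  ∀ x ∈ Ucube ε, ∀ i j, g (refl3 x) i j = sg i * sg j * g x i j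

/-- Partial derivative `∂ₖ f` in `ℝ³`. -/
def pd3 (k : Fin 3) (f : Pt3 → ℝ) (x : Pt3) : ℝ := fderiv ℝ f x (Pi.single k 1)

/-- The Christoffel symbols `Γ^m_{kl}` of the metric `g`. -/
def Gamma (g : Pt3 → Matrix (Fin 3) (Fin 3) ℝ) (m k l : Fin 3) (x : Pt3) : ℝ :=
  (1 / 2) * ∑ q, (g x)⁻¹ m q *
    (pd3 k (fun y => g y q l) x + pd3 l (fun y => g y q k) x - pd3 q (fun y => g y k l) x)

/-- Partial derivative `∂ᵢ u` in `ℝ²`. -/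
def pd2 (i : Fin 2) (u : (Fin 2 → ℝ) → ℝ) (p : Fin 2 → ℝ) : ℝ := fderiv ℝ u p (Pi.single i 1)

/-- The point `(p₁, p₂, z) ∈ ℝ³` over `p = (p₁,p₂) ∈ ℝ²`. -/
def pt3 (p : Fin 2 → ℝ) (z : ℝ) : Pt3 := ![p 0, p 1, z]

/-- The adapted tangent vector `X_i = e_i + d·e₃` (with `d = ∂ᵢu`). -/
def Xv (i : Fin 2) (d : ℝ) : Pt3 :=
  fun k => (if (k : ℕ) = (i : ℕ) then 1 else 0) + (if (k : ℕ) = 2 then d else 0)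

/-- The induced metric `h_{ij} = g(X_i, X_j)` on the graph of `u`. -/
def hmat (g : Pt3 → Matrix (Fin 3) (Fin 3) ℝ) (u : (Fin 2 → ℝ) → ℝ) (p : Fin 2 → ℝ) :
    Matrix (Fin 2) (Fin 2) ℝ :=
  Matrix.of fun i j =>
    ∑ k, ∑ l, g (pt3 p (u p)) k l * Xv i (pd2 i u p) k * Xv j (pd2 j u p) l

/-- The minimal graph operator `F(u)`: the graph `x₃ = u(x₁,x₂)` is a minimal surface of
`(U, g)` exactly when `F(u) = 0`. -/
def Fmin (g : Pt3 → Matrix (Fin 3) (Fin 3) ℝ) (u : (Fin 2 → ℝ) → ℝ) (p : Fin 2 → ℝ) : ℝ :=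
  ∑ i : Fin 2, ∑ j : Fin 2,
    (hmat g u p)⁻¹ i j *
      (pd2 i (pd2 j u) p
        + Gamma g 2 i.castSucc j.castSucc (pt3 p (u p))
        + pd2 i u p * Gamma g 2 2 j.castSucc (pt3 p (u p))
        + pd2 j u p * Gamma g 2 2 i.castSucc (pt3 p (u p))
        + pd2 i u p * pd2 j u p * Gamma g 2 2 2 (pt3 p (u p))
        - ∑ m : Fin 2, pd2 m u p *
            (Gamma g m.castSucc i.castSucc j.castSucc (pt3 p (u p))
              + pd2 i u p * Gamma g m.castSucc 2 j.castSucc (pt3 p (u p))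
              + pd2 j u p * Gamma g m.castSucc i.castSucc 2 (pt3 p (u p))
              + pd2 i u p * pd2 j u p * Gamma g m.castSucc 2 2 (pt3 p (u p))))


/-- The open unit disk `D`. -/
def DdiskSet : Set (ℝ × ℝ) := {q | q.1 ^ 2 + q.2 ^ 2 < 1}

/-- The closed upper half-disk `D⁺`. -/
def DplusSet : Set (ℝ × ℝ) := {q | q.1 ^ 2 + q.2 ^ 2 < 1 ∧ 0 ≤ q.2}

/-- The open upper half-disk. -/
def DupSet : Set (ℝ × ℝ) := {q | q.1 ^ 2 + q.2 ^ 2 < 1 ∧ 0 < q.2}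

/-- The horizontal diameter `δ₀`. -/
def delta0Set : Set (ℝ × ℝ) := {q | q.1 ^ 2 + q.2 ^ 2 < 1 ∧ q.2 = 0}

/-- `∂_u` of an `ℝ³`-valued map on `ℝ²`. -/
def pduV (Y : ℝ × ℝ → Pt3) (q : ℝ × ℝ) : Pt3 := fderiv ℝ Y q ((1 : ℝ), (0 : ℝ))

/-- `∂_v` of an `ℝ³`-valued map on `ℝ²`. -/
def pdvV (Y : ℝ × ℝ → Pt3) (q : ℝ × ℝ) : Pt3 := fderiv ℝ Y q ((0 : ℝ), (1 : ℝ))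

/-- `∂_u` of a scalar function on `ℝ²`. -/
def pduS (f : ℝ × ℝ → ℝ) (q : ℝ × ℝ) : ℝ := fderiv ℝ f q ((1 : ℝ), (0 : ℝ))

/-- `∂_v` of a scalar function on `ℝ²`. -/
def pdvS (f : ℝ × ℝ → ℝ) (q : ℝ × ℝ) : ℝ := fderiv ℝ f q ((0 : ℝ), (1 : ℝ))

/-- The metric `g` evaluated on two tangent vectors at a point `x`. -/
def gform (g : Pt3 → Matrix (Fin 3) (Fin 3) ℝ) (x V W : Pt3) : ℝ :=
  ∑ k, ∑ l, g x k l * V k * W l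

/-- The tension field (harmonic map operator) of the `j`-th component of `Y`. -/
def tension (g : Pt3 → Matrix (Fin 3) (Fin 3) ℝ) (Y : ℝ × ℝ → Pt3) (j : Fin 3)
    (q : ℝ × ℝ) : ℝ :=
  pduS (pduS fun r => Y r j) q + pdvS (pdvS fun r => Y r j) q +
    ∑ k, ∑ l, Gamma g j k l (Y q) *
      (pduS (fun r => Y r k) q * pduS (fun r => Y r l) q +
        pdvS (fun r => Y r k) q * pdvS (fun r => Y r l) q)

/-! ### The half-disk -/

/-- `∂_u` within the closed upper half-disk. -/
def pduPlus (f : ℝ × ℝ → ℝ) (q : ℝ × ℝ) : ℝ := fderivWithin ℝ f DplusSet q ((1 : ℝ), (0 : ℝ))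

/-- `∂_v` within the closed upper half-disk. -/
def pdvPlus (f : ℝ × ℝ → ℝ) (q : ℝ × ℝ) : ℝ := fderivWithin ℝ f DplusSet q ((0 : ℝ), (1 : ℝ))

/-- The extension of `f` from the upper half-disk that is even (`s = 1`) or odd (`s = -1`)
in the second variable. -/
def parityExt (s : ℝ) (f : ℝ × ℝ → ℝ) (q : ℝ × ℝ) : ℝ :=
  if 0 ≤ q.2 then f q else s * f (q.1, -q.2)

/-- The reflection `(u, v) ↦ (u, -v)`. -/
def vflip : ℝ × ℝ →L[ℝ] ℝ × ℝ :=
  (ContinuousLinearMap.fst ℝ ℝ ℝ).prod (-ContinuousLinearMap.snd ℝ ℝ ℝ)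

theorem vflip_apply (q : ℝ × ℝ) : vflip q = (q.1, -q.2) := rfl

theorem isOpen_DdiskSet : IsOpen DdiskSet :=
  isOpen_lt (by fun_prop) continuous_const

theorem isOpen_DupSet : IsOpen DupSet :=
  isOpen_DdiskSet.inter (isOpen_lt continuous_const continuous_snd)

theorem DupSet_subset_DplusSet : DupSet ⊆ DplusSet := fun _ hq => ⟨hq.1, hq.2.le⟩

theorem delta0Set_subset_DplusSet : delta0Set ⊆ DplusSet := fun _ hq => ⟨hq.1, hq.2.ge⟩

theorem openSegment_subset_DupSet {q : ℝ × ℝ} (hq : q ∈ DplusSet) :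
    openSegment ℝ ((0 : ℝ), (1 / 2 : ℝ)) q ⊆ DupSet := by
  rintro _ ⟨a, b, ha, hb, hab, rfl⟩
  obtain ⟨h1, h2⟩ := hq
  have hconv : (b * q.1) ^ 2 + (a * (1 / 2) + b * q.2) ^ 2 ≤
      a * (1 / 4) + b * (q.1 ^ 2 + q.2 ^ 2) := by
    obtain rfl : a = 1 - b := by linarith
    nlinarith [mul_nonneg ha.le (mul_nonneg hb.le (sq_nonneg (q.2 - 1 / 2))),
      mul_nonneg ha.le (mul_nonneg hb.le (sq_nonneg q.1))]
  constructor
  · simp only [Prod.fst_add, Prod.smul_fst, Prod.snd_add, Prod.smul_snd, smul_eq_mul, mul_zero,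
      zero_add]
    nlinarith
  · simp only [Prod.snd_add, Prod.smul_snd, smul_eq_mul]
    nlinarith [mul_nonneg hb.le h2]

theorem DplusSet_subset_closure_DupSet : DplusSet ⊆ closure DupSet := fun q hq =>
  closure_mono (openSegment_subset_DupSet hq)
    (segment_subset_closure_openSegment (right_mem_segment ℝ _ q))

theorem convex_DplusSet : Convex ℝ DplusSet := by
  have hD : Convex ℝ {q : ℝ × ℝ | q.1 ^ 2 + q.2 ^ 2 < 1} := by
    intro p hp q hq a b ha hb hab
    simp only [mem_ofPred_eq] at hp hq
    simp only [mem_ofPred_eq, Prod.fst_add, Prod.smul_fst, Prod.snd_add, Prod.smul_snd, smul_eq_mul]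
    have hconv : (a * p.1 + b * q.1) ^ 2 + (a * p.2 + b * q.2) ^ 2 ≤
        a * (p.1 ^ 2 + p.2 ^ 2) + b * (q.1 ^ 2 + q.2 ^ 2) := by
      obtain rfl : a = 1 - b := by linarith
      nlinarith [mul_nonneg ha (mul_nonneg hb (sq_nonneg (p.1 - q.1))),
        mul_nonneg ha (mul_nonneg hb (sq_nonneg (p.2 - q.2)))]
    rcases ha.eq_or_lt with rfl | ha
    · nlinarith
    · nlinarith
  exact hD.inter (convex_halfSpace_ge (f := Prod.snd) ⟨fun _ _ => rfl, fun _ _ => rfl⟩ 0)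

theorem DupSet_subset_interior : DupSet ⊆ interior DplusSet :=
  interior_maximal DupSet_subset_DplusSet isOpen_DupSet

theorem uniqueDiffOn_DplusSet : UniqueDiffOn ℝ DplusSet :=
  uniqueDiffOn_convex convex_DplusSet
    ⟨((0 : ℝ), (1 / 2 : ℝ)), DupSet_subset_interior (by norm_num [DupSet])⟩

theorem DplusSet_mem_nhds {q : ℝ × ℝ} (hq : q ∈ DupSet) : DplusSet ∈ nhds q :=
  Filter.mem_of_superset (isOpen_DupSet.mem_nhds hq) DupSet_subset_DplusSet

/-- A function that is continuous on the closed half-disk and vanishes on the open one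
vanishes on the closed one. -/
theorem eq_zero_of_eq_zero_on_DupSet {f : ℝ × ℝ → ℝ} (hf : ContinuousOn f DplusSet)
    (h : ∀ q ∈ DupSet, f q = 0) : ∀ q ∈ DplusSet, f q = 0 := fun _ hq =>
  Set.EqOn.of_subset_closure (g := fun _ => 0) h hf continuousOn_const
    DupSet_subset_DplusSet DplusSet_subset_closure_DupSet hq

/-! ### Partial derivatives up to the boundary -/

theorem pduPlus_eq_pduS {f : ℝ × ℝ → ℝ} {q : ℝ × ℝ} (hq : q ∈ DupSet) :
    pduPlus f q = pduS f q := by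
  rw [pduPlus, pduS, fderivWithin_of_mem_nhds (DplusSet_mem_nhds hq)]

theorem pdvPlus_eq_pdvS {f : ℝ × ℝ → ℝ} {q : ℝ × ℝ} (hq : q ∈ DupSet) :
    pdvPlus f q = pdvS f q := by
  rw [pdvPlus, pdvS, fderivWithin_of_mem_nhds (DplusSet_mem_nhds hq)]

theorem pduPlus_pduPlus_eq {f : ℝ × ℝ → ℝ} {q : ℝ × ℝ} (hq : q ∈ DupSet) :
    pduPlus (pduPlus f) q = pduS (pduS f) q := by
  rw [pduPlus_eq_pduS hq, pduS, pduS, Filter.EventuallyEq.fderiv_eq]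
  filter_upwards [isOpen_DupSet.mem_nhds hq] with p hp using pduPlus_eq_pduS hp

theorem pdvPlus_pdvPlus_eq {f : ℝ × ℝ → ℝ} {q : ℝ × ℝ} (hq : q ∈ DupSet) :
    pdvPlus (pdvPlus f) q = pdvS (pdvS f) q := by
  rw [pdvPlus_eq_pdvS hq, pdvS, pdvS, Filter.EventuallyEq.fderiv_eq]
  filter_upwards [isOpen_DupSet.mem_nhds hq] with p hp using pdvPlus_eq_pdvS hp

theorem contDiffOn_pduPlus {f : ℝ × ℝ → ℝ} {m n : WithTop ℕ∞} (hf : ContDiffOn ℝ n f DplusSet)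
    (hmn : m + 1 ≤ n) : ContDiffOn ℝ m (pduPlus f) DplusSet :=
  (hf.fderivWithin uniqueDiffOn_DplusSet hmn).clm_apply contDiffOn_const

theorem contDiffOn_pdvPlus {f : ℝ × ℝ → ℝ} {m n : WithTop ℕ∞} (hf : ContDiffOn ℝ n f DplusSet)
    (hmn : m + 1 ≤ n) : ContDiffOn ℝ m (pdvPlus f) DplusSet :=
  (hf.fderivWithin uniqueDiffOn_DplusSet hmn).clm_apply contDiffOn_const

theorem hasFDerivWithinAt_DplusSet {f : ℝ × ℝ → ℝ} (hf : ContDiffOn ℝ 1 f DplusSet)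
    {q : ℝ × ℝ} (hq : q ∈ DplusSet) :
    HasFDerivWithinAt f (pduPlus f q • ContinuousLinearMap.fst ℝ ℝ ℝ +
      pdvPlus f q • ContinuousLinearMap.snd ℝ ℝ ℝ) DplusSet q := by
  refine (hf.differentiableOn one_ne_zero q hq).hasFDerivWithinAt.congr_fderiv ?_
  ext <;> simp [pduPlus, pdvPlus]

theorem pduPlus_pdvPlus_comm {f : ℝ × ℝ → ℝ} (hf : ContDiffOn ℝ 2 f DplusSet) {q : ℝ × ℝ}
    (hq : q ∈ DplusSet) : pduPlus (pdvPlus f) q = pdvPlus (pduPlus f) q := by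
  have hU := uniqueDiffOn_DplusSet q hq
  have hd : DifferentiableWithinAt ℝ (fderivWithin ℝ f DplusSet) DplusSet q :=
    (hf.fderivWithin uniqueDiffOn_DplusSet (m := 1) (by norm_num)).differentiableOn
      one_ne_zero q hq
  have hsymm : IsSymmSndFDerivWithinAt ℝ f DplusSet q :=
    (hf q hq).isSymmSndFDerivWithinAt (by simp) uniqueDiffOn_DplusSet
      (closure_mono DupSet_subset_interior (DplusSet_subset_closure_DupSet hq)) hq
  have key : ∀ a b : ℝ × ℝ, fderivWithin ℝ (fun p => fderivWithin ℝ f DplusSet p a) DplusSet q b =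
      fderivWithin ℝ (fderivWithin ℝ f DplusSet) DplusSet q b a := fun a b => by
    rw [fderivWithin_clm_apply hU hd (differentiableWithinAt_const a)]
    simp
  exact (key _ _).trans ((hsymm _ _).trans (key _ _).symm)

theorem hasDerivAt_pduPlus {f : ℝ × ℝ → ℝ} (hf : ContDiffOn ℝ 1 f DplusSet) {t : ℝ}
    (ht : t ^ 2 < 1) : HasDerivAt (fun s : ℝ => f (s, 0)) (pduPlus f (t, 0)) t := by
  have hS : IsOpen {s : ℝ | s ^ 2 < 1} := isOpen_lt (by fun_prop) continuous_const
  have hmaps : MapsTo (fun s : ℝ => (s, (0 : ℝ))) {s : ℝ | s ^ 2 < 1} DplusSet := fun s hs => by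
    simpa [DplusSet] using hs
  have hline : HasDerivWithinAt (fun s : ℝ => (s, (0 : ℝ))) ((1 : ℝ), (0 : ℝ))
      {s : ℝ | s ^ 2 < 1} t :=
    ((hasDerivAt_id t).prodMk (hasDerivAt_const t (0 : ℝ))).hasDerivWithinAt
  have := (hf.differentiableOn one_ne_zero _ (hmaps ht)).hasFDerivWithinAt.comp_hasDerivWithinAt t
    hline hmaps
  exact this.hasDerivAt (hS.mem_nhds ht)

theorem pduPlus_eq_zero {f : ℝ × ℝ → ℝ} (hf : ContDiffOn ℝ 1 f DplusSet)
    (h0 : ∀ q ∈ delta0Set, f q = 0) : ∀ q ∈ delta0Set, pduPlus f q = 0 := by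
  rintro ⟨t, v⟩ hq
  obtain ⟨h1, rfl : v = 0⟩ := hq
  have ht : t ^ 2 < 1 := by simpa using h1
  refine (hasDerivAt_pduPlus hf ht).unique ((hasDerivAt_const t (0 : ℝ)).congr_of_eventuallyEq ?_)
  have hS : IsOpen {s : ℝ | s ^ 2 < 1} := isOpen_lt (by fun_prop) continuous_const
  filter_upwards [hS.mem_nhds ht] with s hs
  exact h0 _ ⟨by simpa using hs, rfl⟩

/-! ### Even and odd extensions -/

theorem DdiskSet_eq_union : DdiskSet = DplusSet ∪ vflip ⁻¹' DplusSet := by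
  ext q
  simp only [DdiskSet, DplusSet, mem_ofPred_eq, mem_union, mem_preimage, vflip_apply, neg_sq]
  rcases le_total 0 q.2 with h | h
  · tauto
  · have : 0 ≤ -q.2 := by linarith
    tauto

theorem notMem_closure_DplusSet {q : ℝ × ℝ} (hq : q ∈ DdiskSet) (h : q ∉ DplusSet) :
    q ∉ closure DplusSet := fun hc =>
  h ⟨hq, closure_minimal (fun _ hp => hp.2) (isClosed_le continuous_const continuous_snd) hc⟩

theorem notMem_closure_vflip_DplusSet {q : ℝ × ℝ} (hq : q ∈ DdiskSet)
    (h : q ∉ vflip ⁻¹' DplusSet) : q ∉ closure (vflip ⁻¹' DplusSet) := fun hc =>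
  h ⟨by simpa [vflip_apply, DdiskSet] using hq,
    closure_minimal (t := {p : ℝ × ℝ | 0 ≤ -p.2}) (fun _ hp => hp.2)
      (isClosed_le continuous_const continuous_snd.neg) hc⟩

theorem parityExt_of_mem {s : ℝ} {f : ℝ × ℝ → ℝ} {q : ℝ × ℝ} (hq : q ∈ DplusSet) :
    parityExt s f q = f q := if_pos hq.2

theorem parityExt_of_vflip_mem {s : ℝ} {f : ℝ × ℝ → ℝ} (h0 : ∀ q ∈ delta0Set, f q = s * f q)
    {q : ℝ × ℝ} (hq : vflip q ∈ DplusSet) : parityExt s f q = s * f (vflip q) := by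
  obtain ⟨h1, h2⟩ := hq
  simp only [vflip_apply, neg_sq] at h1 h2
  rcases (neg_nonneg.1 h2).eq_or_lt with h | h
  · have hflip : vflip q = q := by ext <;> simp [vflip_apply, h]
    rw [hflip, parityExt, if_pos h.ge]
    exact h0 q ⟨h1, h⟩
  · exact if_neg h.not_ge

theorem continuousOn_parityExt {s : ℝ} {f : ℝ × ℝ → ℝ} (hf : ContinuousOn f DplusSet)
    (h0 : ∀ q ∈ delta0Set, f q = s * f q) : ContinuousOn (parityExt s f) DdiskSet := by
  intro q hq
  have h1 : ContinuousWithinAt (parityExt s f) DplusSet q := by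
    by_cases h : q ∈ DplusSet
    · exact (hf q h).congr (fun _ hp => parityExt_of_mem hp) (parityExt_of_mem h)
    · exact continuousWithinAt_of_notMem_closure (notMem_closure_DplusSet hq h)
  have h2 : ContinuousWithinAt (parityExt s f) (vflip ⁻¹' DplusSet) q := by
    by_cases h : q ∈ vflip ⁻¹' DplusSet
    · have hc : ContinuousOn (fun p => s * f (vflip p)) (vflip ⁻¹' DplusSet) :=
        continuousOn_const.mul (hf.comp vflip.continuous.continuousOn fun _ hp => hp)
      exact (hc q h).congr (fun _ hp => parityExt_of_vflip_mem h0 hp)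
        (parityExt_of_vflip_mem h0 h)
    · exact continuousWithinAt_of_notMem_closure (notMem_closure_vflip_DplusSet hq h)
  rw [DdiskSet_eq_union]
  exact h1.union h2

theorem hasFDerivAt_parityExt {s : ℝ} {f : ℝ × ℝ → ℝ} (hf : ContDiffOn ℝ 1 f DplusSet)
    (h0 : ∀ q ∈ delta0Set, f q = s * f q)
    (hu : ∀ q ∈ delta0Set, pduPlus f q = s * pduPlus f q)
    (hv : ∀ q ∈ delta0Set, pdvPlus f q = -s * pdvPlus f q) {q : ℝ × ℝ} (hq : q ∈ DdiskSet) :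
    HasFDerivAt (parityExt s f) (parityExt s (pduPlus f) q • ContinuousLinearMap.fst ℝ ℝ ℝ +
      parityExt (-s) (pdvPlus f) q • ContinuousLinearMap.snd ℝ ℝ ℝ) q := by
  refine HasFDerivWithinAt.hasFDerivAt (s := DdiskSet) ?_ (isOpen_DdiskSet.mem_nhds hq)
  rw [DdiskSet_eq_union]
  refine HasFDerivWithinAt.union ?_ ?_
  · by_cases h : q ∈ DplusSet
    · rw [parityExt_of_mem h, parityExt_of_mem h]
      exact (hasFDerivWithinAt_DplusSet hf h).congr (fun _ hp => parityExt_of_mem hp)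
        (parityExt_of_mem h)
    · exact HasFDerivWithinAt.of_notMem_closure (notMem_closure_DplusSet hq h)
  · by_cases h : q ∈ vflip ⁻¹' DplusSet
    · rw [parityExt_of_vflip_mem hu h, parityExt_of_vflip_mem hv h]
      have hd := ((hasFDerivWithinAt_DplusSet hf h).comp q
        (vflip.hasFDerivAt.hasFDerivWithinAt (s := vflip ⁻¹' DplusSet))
        (fun _ hp => hp)).const_mul s
      refine (hd.congr_fderiv ?_).congr (fun _ hp => parityExt_of_vflip_mem h0 hp)
        (parityExt_of_vflip_mem h0 h)
      ext <;> simp [vflip_apply]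
    · exact HasFDerivWithinAt.of_notMem_closure (notMem_closure_vflip_DplusSet hq h)

theorem contDiffOn_succ_of_hasFDerivAt {F A B : ℝ × ℝ → ℝ} {n : ℕ}
    (hF : ∀ q ∈ DdiskSet, HasFDerivAt F
      (A q • ContinuousLinearMap.fst ℝ ℝ ℝ + B q • ContinuousLinearMap.snd ℝ ℝ ℝ) q)
    (hA : ContDiffOn ℝ n A DdiskSet) (hB : ContDiffOn ℝ n B DdiskSet) :
    ContDiffOn ℝ (n + 1) F DdiskSet :=
  (contDiffOn_succ_iff_hasFDerivWithinAt_of_uniqueDiffOn isOpen_DdiskSet.uniqueDiffOn).2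
    ⟨fun h => by simp at h, _, (hA.smul contDiffOn_const).add (hB.smul contDiffOn_const),
      fun q hq => (hF q hq).hasFDerivWithinAt⟩

theorem contDiffOn_one_parityExt {s : ℝ} {f : ℝ × ℝ → ℝ} (hf : ContDiffOn ℝ 1 f DplusSet)
    (h0 : ∀ q ∈ delta0Set, f q = s * f q)
    (hu : ∀ q ∈ delta0Set, pduPlus f q = s * pduPlus f q)
    (hv : ∀ q ∈ delta0Set, pdvPlus f q = -s * pdvPlus f q) :
    ContDiffOn ℝ 1 (parityExt s f) DdiskSet := by
  have h := contDiffOn_succ_of_hasFDerivAt (n := 0)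
    (fun q hq => hasFDerivAt_parityExt hf h0 hu hv hq)
    (contDiffOn_zero.2 (continuousOn_parityExt (contDiffOn_pduPlus (m := 0) hf (by simp)).continuousOn hu))
    (contDiffOn_zero.2 (continuousOn_parityExt (contDiffOn_pdvPlus (m := 0) hf (by simp)).continuousOn hv))
  simpa using h

theorem pduS_parityExt {s : ℝ} {f : ℝ × ℝ → ℝ} (hf : ContDiffOn ℝ 1 f DplusSet)
    (h0 : ∀ q ∈ delta0Set, f q = s * f q)
    (hu : ∀ q ∈ delta0Set, pduPlus f q = s * pduPlus f q)
    (hv : ∀ q ∈ delta0Set, pdvPlus f q = -s * pdvPlus f q) {q : ℝ × ℝ} (hq : q ∈ DdiskSet) :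
    pduS (parityExt s f) q = parityExt s (pduPlus f) q := by
  rw [pduS, (hasFDerivAt_parityExt hf h0 hu hv hq).fderiv]
  simp

theorem pdvS_parityExt {s : ℝ} {f : ℝ × ℝ → ℝ} (hf : ContDiffOn ℝ 1 f DplusSet)
    (h0 : ∀ q ∈ delta0Set, f q = s * f q)
    (hu : ∀ q ∈ delta0Set, pduPlus f q = s * pduPlus f q)
    (hv : ∀ q ∈ delta0Set, pdvPlus f q = -s * pdvPlus f q) {q : ℝ × ℝ} (hq : q ∈ DdiskSet) :
    pdvS (parityExt s f) q = parityExt (-s) (pdvPlus f) q := by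
  rw [pdvS, (hasFDerivAt_parityExt hf h0 hu hv hq).fderiv]
  simp

/-- The compatibility conditions on the diameter under which the extension of parity `s` of a
`C²` function on the closed half-disk is `C²`. -/
structure ParityCompatible (s : ℝ) (f : ℝ × ℝ → ℝ) : Prop where
  contDiffOn : ContDiffOn ℝ 2 f DplusSet
  val : ∀ q ∈ delta0Set, f q = s * f q
  du : ∀ q ∈ delta0Set, pduPlus f q = s * pduPlus f q
  dv : ∀ q ∈ delta0Set, pdvPlus f q = -s * pdvPlus f q
  duu : ∀ q ∈ delta0Set, pduPlus (pduPlus f) q = s * pduPlus (pduPlus f) q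
  duv : ∀ q ∈ delta0Set, pduPlus (pdvPlus f) q = -s * pduPlus (pdvPlus f) q
  dvv : ∀ q ∈ delta0Set, pdvPlus (pdvPlus f) q = s * pdvPlus (pdvPlus f) q

namespace ParityCompatible

variable {s : ℝ} {f : ℝ × ℝ → ℝ}

theorem contDiffOn_one (h : ParityCompatible s f) : ContDiffOn ℝ 1 f DplusSet :=
  h.contDiffOn.of_le (by norm_num)

theorem contDiffOn_du (h : ParityCompatible s f) : ContDiffOn ℝ 1 (pduPlus f) DplusSet :=
  contDiffOn_pduPlus h.contDiffOn (by norm_num)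

theorem contDiffOn_dv (h : ParityCompatible s f) : ContDiffOn ℝ 1 (pdvPlus f) DplusSet :=
  contDiffOn_pdvPlus h.contDiffOn (by norm_num)

theorem dvu (h : ParityCompatible s f) :
    ∀ q ∈ delta0Set, pdvPlus (pduPlus f) q = -s * pdvPlus (pduPlus f) q := fun q hq => by
  rw [← pduPlus_pdvPlus_comm h.contDiffOn (delta0Set_subset_DplusSet hq)]
  exact h.duv q hq

theorem dvv_neg (h : ParityCompatible s f) :
    ∀ q ∈ delta0Set, pdvPlus (pdvPlus f) q = - -s * pdvPlus (pdvPlus f) q := by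
  simpa using h.dvv

theorem pduS_eq (h : ParityCompatible s f) {q : ℝ × ℝ} (hq : q ∈ DdiskSet) :
    pduS (parityExt s f) q = parityExt s (pduPlus f) q :=
  pduS_parityExt h.contDiffOn_one h.val h.du h.dv hq

theorem pdvS_eq (h : ParityCompatible s f) {q : ℝ × ℝ} (hq : q ∈ DdiskSet) :
    pdvS (parityExt s f) q = parityExt (-s) (pdvPlus f) q :=
  pdvS_parityExt h.contDiffOn_one h.val h.du h.dv hq

theorem pduS_pduS_eq (h : ParityCompatible s f) {q : ℝ × ℝ} (hq : q ∈ DdiskSet) :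
    pduS (pduS (parityExt s f)) q = parityExt s (pduPlus (pduPlus f)) q := by
  rw [← pduS_parityExt h.contDiffOn_du h.du h.duu h.dvu hq, pduS, pduS,
    Filter.EventuallyEq.fderiv_eq]
  filter_upwards [isOpen_DdiskSet.mem_nhds hq] with p hp using h.pduS_eq hp

theorem pdvS_pdvS_eq (h : ParityCompatible s f) {q : ℝ × ℝ} (hq : q ∈ DdiskSet) :
    pdvS (pdvS (parityExt s f)) q = parityExt s (pdvPlus (pdvPlus f)) q := by
  have key := pdvS_parityExt h.contDiffOn_dv h.dv h.duv h.dvv_neg hq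
  rw [neg_neg] at key
  rw [← key, pdvS, pdvS, Filter.EventuallyEq.fderiv_eq]
  filter_upwards [isOpen_DdiskSet.mem_nhds hq] with p hp using h.pdvS_eq hp

theorem contDiffOn_parityExt (h : ParityCompatible s f) :
    ContDiffOn ℝ 2 (parityExt s f) DdiskSet := by
  have key := contDiffOn_succ_of_hasFDerivAt (n := 1)
    (fun q hq => hasFDerivAt_parityExt h.contDiffOn_one h.val h.du h.dv hq)
    (contDiffOn_one_parityExt h.contDiffOn_du h.du h.duu h.dvu)
    (contDiffOn_one_parityExt h.contDiffOn_dv h.dv h.duv h.dvv_neg)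
  norm_num at key
  exact key

end ParityCompatible

/-! ### Behaviour of the metric under the reflection -/

theorem sg_mul_self (i : Fin 3) : sg i * sg i = 1 := by
  fin_cases i <;> simp [sg]

theorem isOpen_Ucube (ε : ℝ) : IsOpen (Ucube ε) := by
  have : Ucube ε = ⋂ i, {x : Pt3 | |x i| < ε} := by ext; simp [Ucube]
  rw [this]
  exact isOpen_iInter_of_finite fun i => isOpen_lt (by fun_prop) continuous_const

theorem refl3_mem_Ucube {ε : ℝ} {x : Pt3} (hx : x ∈ Ucube ε) : refl3 x ∈ Ucube ε := fun i => by
  have h : |sg i| = 1 := by fin_cases i <;> simp [sg]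
  simpa [refl3, abs_mul, h] using hx i

/-- The reflection `I` as a continuous linear map. -/
def refl3CLM : Pt3 →L[ℝ] Pt3 :=
  ContinuousLinearMap.pi fun i => sg i • (ContinuousLinearMap.proj i : Pt3 →L[ℝ] ℝ)

theorem hasFDerivAt_refl3 (x : Pt3) : HasFDerivAt refl3 refl3CLM x :=
  refl3CLM.hasFDerivAt

theorem refl3CLM_single (k : Fin 3) : refl3CLM (Pi.single k 1) = sg k • Pi.single k 1 := by
  ext m
  by_cases hm : m = k
  · subst hm; simp [refl3CLM]
  · simp [refl3CLM, hm]

section Metric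

variable {ε : ℝ} {g : Pt3 → Matrix (Fin 3) (Fin 3) ℝ}

theorem pd3_refl3 (hsm : SmoothMetric ε g) (hinv : IInvariant ε g) {x : Pt3} (hx : x ∈ Ucube ε)
    (i j k : Fin 3) :
    pd3 k (fun y => g y i j) (refl3 x) = sg i * sg j * sg k * pd3 k (fun y => g y i j) x := by
  have hd : ∀ y ∈ Ucube ε, DifferentiableAt ℝ (fun y => g y i j) y := fun y hy =>
    ((hsm.1 i j).contDiffAt ((isOpen_Ucube ε).mem_nhds hy)).differentiableAt (by simp)
  have h1 := (hd _ (refl3_mem_Ucube hx)).hasFDerivAt.comp x (hasFDerivAt_refl3 x)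
  have h2 := ((hd x hx).hasFDerivAt.const_mul (sg i * sg j)).congr_of_eventuallyEq
    (f₁ := (fun y => g y i j) ∘ refl3) (by
      filter_upwards [(isOpen_Ucube ε).mem_nhds hx] with y hy using hinv y hy i j)
  have h3 := DFunLike.congr_fun (h1.unique h2) (Pi.single k 1)
  simp only [ContinuousLinearMap.comp_apply, refl3CLM_single, map_smul, smul_eq_mul,
    _root_.smul_apply] at h3
  simp only [pd3]
  linear_combination sg k * h3 - fderiv ℝ (fun y => g y i j) (refl3 x) (Pi.single k 1) *
    sg_mul_self k

theorem inv_refl3 (hinv : IInvariant ε g) {x : Pt3} (hx : x ∈ Ucube ε) (i j : Fin 3) :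
    (g (refl3 x))⁻¹ i j = sg i * sg j * (g x)⁻¹ i j := by
  have hg : g (refl3 x) = diagonal sg * g x * diagonal sg := by
    ext k l
    rw [hinv x hx, mul_diagonal, diagonal_mul]
    ring
  have hsg : (diagonal sg)⁻¹ = diagonal sg := by
    refine Matrix.inv_eq_right_inv ?_
    rw [diagonal_mul_diagonal, ← diagonal_one]
    exact congrArg diagonal (funext sg_mul_self)
  rw [hg, Matrix.mul_inv_rev, Matrix.mul_inv_rev, hsg, ← mul_assoc, mul_diagonal, diagonal_mul]
  ring

theorem Gamma_refl3 (hsm : SmoothMetric ε g) (hinv : IInvariant ε g) {x : Pt3}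
    (hx : x ∈ Ucube ε) (m k l : Fin 3) :
    Gamma g m k l (refl3 x) = sg m * sg k * sg l * Gamma g m k l x := by
  simp only [Gamma, pd3_refl3 hsm hinv hx, inv_refl3 hinv hx]
  rw [mul_left_comm (sg m * sg k * sg l), Finset.mul_sum _ _ (sg m * sg k * sg l)]
  refine congrArg (1 / 2 * ·) (Finset.sum_congr rfl fun q _ => ?_)
  linear_combination (sg m * sg k * sg l * (g x)⁻¹ m q * (pd3 k (fun y => g y q l) x +
    pd3 l (fun y => g y q k) x - pd3 q (fun y => g y k l) x)) * sg_mul_self q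

theorem gform_refl3 (hinv : IInvariant ε g) {x : Pt3} (hx : x ∈ Ucube ε) (V W : Pt3) :
    gform g (refl3 x) (refl3 V) (refl3 W) = gform g x V W := by
  unfold gform
  refine Finset.sum_congr rfl fun k _ => Finset.sum_congr rfl fun l _ => ?_
  rw [hinv x hx, refl3, refl3]
  linear_combination (g x k l * V k * W l) * (sg l * sg l * sg_mul_self k + sg_mul_self l)

theorem continuousOn_pd3 (hsm : SmoothMetric ε g) (i j k : Fin 3) :
    ContinuousOn (pd3 k fun y => g y i j) (Ucube ε) :=
  ((hsm.1 i j).continuousOn_fderiv_of_isOpen (isOpen_Ucube ε) (by simp)).clm_apply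
    continuousOn_const

theorem continuousOn_metric_inv (hsm : SmoothMetric ε g) (i j : Fin 3) :
    ContinuousOn (fun x => (g x)⁻¹ i j) (Ucube ε) := by
  have hg : ContinuousOn g (Ucube ε) :=
    continuousOn_pi.2 fun k => continuousOn_pi.2 fun l => (hsm.1 k l).continuousOn
  have hdet : ContinuousOn (fun x => (g x).det) (Ucube ε) :=
    (continuous_id.matrix_det).comp_continuousOn hg
  have hadj : ContinuousOn (fun x => (g x).adjugate i j) (Ucube ε) :=
    ((continuous_id.matrix_adjugate).matrix_elem i j).comp_continuousOn hg
  refine ((hdet.inv₀ fun x hx => (hsm.2 x hx).det_pos.ne').mul hadj).congr fun x _ => ?_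
  simp [Matrix.inv_def]

theorem continuousOn_Gamma (hsm : SmoothMetric ε g) (m k l : Fin 3) :
    ContinuousOn (Gamma g m k l) (Ucube ε) :=
  continuousOn_const.mul <| continuousOn_finsetSum _ fun q _ =>
    (continuousOn_metric_inv hsm m q).mul
      (((continuousOn_pd3 hsm q l k).add (continuousOn_pd3 hsm q k l)).sub
        (continuousOn_pd3 hsm k l q))

end Metric

/-! ### Conformality and harmonicity up to the diameter -/

/-- The vector `∂_u X` within the closed upper half-disk. -/
def pduPlusV (X : ℝ × ℝ → Pt3) (q : ℝ × ℝ) : Pt3 := fun k => pduPlus (fun r => X r k) q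

/-- The vector `∂_v X` within the closed upper half-disk. -/
def pdvPlusV (X : ℝ × ℝ → Pt3) (q : ℝ × ℝ) : Pt3 := fun k => pdvPlus (fun r => X r k) q

/-- The tension field computed with derivatives within the closed upper half-disk. -/
def tensionPlus (g : Pt3 → Matrix (Fin 3) (Fin 3) ℝ) (X : ℝ × ℝ → Pt3) (j : Fin 3)
    (q : ℝ × ℝ) : ℝ :=
  pduPlus (pduPlus fun r => X r j) q + pdvPlus (pdvPlus fun r => X r j) q +
    ∑ k, ∑ l, Gamma g j k l (X q) *
      (pduPlusV X q k * pduPlusV X q l + pdvPlusV X q k * pdvPlusV X q l)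

theorem pduV_apply {Y : ℝ × ℝ → Pt3} {q : ℝ × ℝ} (hY : DifferentiableAt ℝ Y q) (k : Fin 3) :
    pduV Y q k = pduS (fun r => Y r k) q := by
  rw [pduV, pduS, ((hasFDerivAt_pi'.1 hY.hasFDerivAt) k).fderiv]
  rfl

theorem pdvV_apply {Y : ℝ × ℝ → Pt3} {q : ℝ × ℝ} (hY : DifferentiableAt ℝ Y q) (k : Fin 3) :
    pdvV Y q k = pdvS (fun r => Y r k) q := by
  rw [pdvV, pdvS, ((hasFDerivAt_pi'.1 hY.hasFDerivAt) k).fderiv]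
  rfl

section HalfDisk

variable {ε : ℝ} {g : Pt3 → Matrix (Fin 3) (Fin 3) ℝ} {X : ℝ × ℝ → Pt3}

theorem contDiffOn_component (hX : ContDiffOn ℝ 2 X DplusSet) (k : Fin 3) :
    ContDiffOn ℝ 2 (fun r => X r k) DplusSet := contDiffOn_pi.1 hX k

theorem continuousOn_pduPlusV (hX : ContDiffOn ℝ 2 X DplusSet) (k : Fin 3) :
    ContinuousOn (fun q => pduPlusV X q k) DplusSet :=
  (contDiffOn_pduPlus (m := 1) (contDiffOn_component hX k) (by norm_num)).continuousOn

theorem continuousOn_pdvPlusV (hX : ContDiffOn ℝ 2 X DplusSet) (k : Fin 3) :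
    ContinuousOn (fun q => pdvPlusV X q k) DplusSet :=
  (contDiffOn_pdvPlus (m := 1) (contDiffOn_component hX k) (by norm_num)).continuousOn

theorem pduV_eq_pduPlusV (hX : ContDiffOn ℝ 2 X DplusSet) {q : ℝ × ℝ} (hq : q ∈ DupSet) :
    pduV X q = pduPlusV X q := by
  have hd : DifferentiableAt ℝ X q := (hX.contDiffAt (DplusSet_mem_nhds hq)).differentiableAt
    two_ne_zero
  exact funext fun k => (pduV_apply hd k).trans (pduPlus_eq_pduS hq).symm

theorem pdvV_eq_pdvPlusV (hX : ContDiffOn ℝ 2 X DplusSet) {q : ℝ × ℝ} (hq : q ∈ DupSet) :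
    pdvV X q = pdvPlusV X q := by
  have hd : DifferentiableAt ℝ X q := (hX.contDiffAt (DplusSet_mem_nhds hq)).differentiableAt
    two_ne_zero
  exact funext fun k => (pdvV_apply hd k).trans (pdvPlus_eq_pdvS hq).symm

theorem tensionPlus_eq_tension {q : ℝ × ℝ} (hq : q ∈ DupSet) (j : Fin 3) :
    tensionPlus g X j q = tension g X j q := by
  simp only [tensionPlus, tension, pduPlusV, pdvPlusV, pduPlus_pduPlus_eq hq,
    pdvPlus_pdvPlus_eq hq, pduPlus_eq_pduS hq, pdvPlus_eq_pdvS hq]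

theorem continuousOn_gform (hsm : SmoothMetric ε g) (hX : ContDiffOn ℝ 2 X DplusSet)
    (hrange : ∀ q ∈ DplusSet, X q ∈ Ucube ε) {V W : ℝ × ℝ → Pt3}
    (hV : ∀ k, ContinuousOn (fun q => V q k) DplusSet)
    (hW : ∀ k, ContinuousOn (fun q => W q k) DplusSet) :
    ContinuousOn (fun q => gform g (X q) (V q) (W q)) DplusSet :=
  continuousOn_finsetSum _ fun k _ => continuousOn_finsetSum _ fun l _ =>
    (((hsm.1 k l).continuousOn.comp hX.continuousOn hrange).mul (hV k)).mul (hW l)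

theorem continuousOn_tensionPlus (hsm : SmoothMetric ε g) (hX : ContDiffOn ℝ 2 X DplusSet)
    (hrange : ∀ q ∈ DplusSet, X q ∈ Ucube ε) (j : Fin 3) :
    ContinuousOn (tensionPlus g X j) DplusSet := by
  have huu := contDiffOn_pduPlus (m := 0) (contDiffOn_pduPlus (m := 1)
    (contDiffOn_component hX j) (by norm_num)) (by simp)
  have hvv := contDiffOn_pdvPlus (m := 0) (contDiffOn_pdvPlus (m := 1)
    (contDiffOn_component hX j) (by norm_num)) (by simp)
  exact (huu.continuousOn.add hvv.continuousOn).add <|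
    continuousOn_finsetSum _ fun k _ => continuousOn_finsetSum _ fun l _ =>
      ((continuousOn_Gamma hsm j k l).comp hX.continuousOn hrange).mul
        (((continuousOn_pduPlusV hX k).mul (continuousOn_pduPlusV hX l)).add
          ((continuousOn_pdvPlusV hX k).mul (continuousOn_pdvPlusV hX l)))

theorem conformal_DplusSet (hsm : SmoothMetric ε g) (hX : ContDiffOn ℝ 2 X DplusSet)
    (hrange : ∀ q ∈ DplusSet, X q ∈ Ucube ε)
    (hconf : ∀ q ∈ DupSet,
      gform g (X q) (pduV X q) (pduV X q) = gform g (X q) (pdvV X q) (pdvV X q) ∧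
      gform g (X q) (pduV X q) (pdvV X q) = 0) {q : ℝ × ℝ} (hq : q ∈ DplusSet) :
    gform g (X q) (pduPlusV X q) (pduPlusV X q) = gform g (X q) (pdvPlusV X q) (pdvPlusV X q) ∧
      gform g (X q) (pduPlusV X q) (pdvPlusV X q) = 0 := by
  have hu := continuousOn_pduPlusV hX
  have hv := continuousOn_pdvPlusV hX
  constructor
  · refine sub_eq_zero.1 (eq_zero_of_eq_zero_on_DupSet
      ((continuousOn_gform hsm hX hrange hu hu).sub (continuousOn_gform hsm hX hrange hv hv))
      (fun p hp => ?_) q hq)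
    rw [Pi.sub_apply, ← pduV_eq_pduPlusV hX hp, ← pdvV_eq_pdvPlusV hX hp, (hconf p hp).1,
      sub_self]
  · refine eq_zero_of_eq_zero_on_DupSet (continuousOn_gform hsm hX hrange hu hv)
      (fun p hp => ?_) q hq
    rw [← pduV_eq_pduPlusV hX hp, ← pdvV_eq_pdvPlusV hX hp, (hconf p hp).2]

theorem tensionPlus_eq_zero (hsm : SmoothMetric ε g) (hX : ContDiffOn ℝ 2 X DplusSet)
    (hrange : ∀ q ∈ DplusSet, X q ∈ Ucube ε)
    (hharm : ∀ q ∈ DupSet, ∀ j : Fin 3, tension g X j q = 0) (j : Fin 3) :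
    ∀ q ∈ DplusSet, tensionPlus g X j q = 0 :=
  eq_zero_of_eq_zero_on_DupSet (continuousOn_tensionPlus hsm hX hrange j) fun q hq =>
    (tensionPlus_eq_tension hq j).trans (hharm q hq j)

theorem pduPlusV_eq_zero (hX : ContDiffOn ℝ 2 X DplusSet) {k : Fin 3}
    (hk : ∀ q ∈ delta0Set, X q k = 0) : ∀ q ∈ delta0Set, pduPlusV X q k = 0 :=
  pduPlus_eq_zero ((contDiffOn_component hX k).of_le (by norm_num)) hk

theorem refl3_eq_self {x : Pt3} (h1 : x 1 = 0) (h2 : x 2 = 0) : refl3 x = x := by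
  ext i
  fin_cases i <;> simp [refl3, sg, h1, h2]

/-- At points of the diameter the conormal derivative of the axial component vanishes. -/
theorem pdvPlusV_zero_eq_zero (hsm : SmoothMetric ε g) (hinv : IInvariant ε g)
    (hX : ContDiffOn ℝ 2 X DplusSet) (hrange : ∀ q ∈ DplusSet, X q ∈ Ucube ε)
    (haxis : ∀ q ∈ delta0Set, X q 1 = 0 ∧ X q 2 = 0)
    (hne : ∀ t : ℝ, t ^ 2 < 1 → t ≠ 0 → deriv (fun s : ℝ => X (s, 0)) t ≠ 0)
    (horth : ∀ q ∈ DplusSet, gform g (X q) (pduPlusV X q) (pdvPlusV X q) = 0) :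
    ∀ q ∈ delta0Set, pdvPlusV X q 0 = 0 := by
  have hu1 := pduPlusV_eq_zero hX fun q hq => (haxis q hq).1
  have hu2 := pduPlusV_eq_zero hX fun q hq => (haxis q hq).2
  have hmem : ∀ t : ℝ, t ^ 2 < 1 → (t, (0 : ℝ)) ∈ delta0Set := fun t ht => by
    simpa [delta0Set] using ht
  have hoff : ∀ t : ℝ, t ^ 2 < 1 → t ≠ 0 → pdvPlusV X (t, 0) 0 = 0 := by
    intro t ht ht0
    have hq := hmem t ht
    have hqP := delta0Set_subset_DplusSet hq
    have hgsymm := hinv _ (hrange _ hqP)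
    rw [refl3_eq_self (haxis _ hq).1 (haxis _ hq).2] at hgsymm
    have h01 : g (X (t, 0)) 0 1 = 0 := by
      have := hgsymm 0 1
      simp only [sg, cons_val_zero, cons_val_one] at this
      linarith
    have h02 : g (X (t, 0)) 0 2 = 0 := by
      have := hgsymm 0 2
      simp only [sg, cons_val_zero, cons_val] at this
      linarith
    have h00 : g (X (t, 0)) 0 0 ≠ 0 := ((hsm.2 _ (hrange _ hqP)).diag_pos (i := 0)).ne'
    have hu0 : pduPlusV X (t, 0) 0 ≠ 0 := by
      intro h0
      refine hne t ht ht0 ?_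
      have hd : HasDerivAt (fun s : ℝ => X (s, 0)) (pduPlusV X (t, 0)) t :=
        hasDerivAt_pi.2 fun k =>
          hasDerivAt_pduPlus ((contDiffOn_component hX k).of_le (by norm_num)) ht
      rw [hd.deriv]
      ext k
      fin_cases k
      · exact h0
      · exact hu1 _ hq
      · exact hu2 _ hq
    have := horth _ hqP
    simp only [gform, Fin.sum_univ_three, hu1 _ hq, hu2 _ hq, h01, h02, mul_zero, zero_mul,
      add_zero] at this
    simpa [h00, hu0] using this
  have hS : IsOpen {t : ℝ | t ^ 2 < 1} := isOpen_lt (by fun_prop) continuous_const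
  have hcont : ContinuousOn (fun t : ℝ => pdvPlusV X (t, 0) 0) {t : ℝ | t ^ 2 < 1} :=
    (continuousOn_pdvPlusV hX 0).comp (f := fun t : ℝ => (t, (0 : ℝ))) (by fun_prop)
      fun t ht => delta0Set_subset_DplusSet (hmem t ht)
  have hall : EqOn (fun t : ℝ => pdvPlusV X (t, 0) 0) (fun _ => 0) {t : ℝ | t ^ 2 < 1} :=
    Set.EqOn.of_subset_closure (s := {t : ℝ | t ^ 2 < 1} ∩ {0}ᶜ)
      (fun t ht => hoff t ht.1 ht.2) hcont continuousOn_const inter_subset_left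
      ((dense_compl_singleton (0 : ℝ)).open_subset_closure_inter hS)
  rintro ⟨t, v⟩ ⟨h1, rfl : v = 0⟩
  exact hall (by simpa using h1)

/-- The components of a conformal harmonic half-disk satisfy the compatibility conditions
of their parity under the reflection. -/
theorem parityCompatible_component (hsm : SmoothMetric ε g) (hinv : IInvariant ε g)
    (hX : ContDiffOn ℝ 2 X DplusSet) (hrange : ∀ q ∈ DplusSet, X q ∈ Ucube ε)
    (haxis : ∀ q ∈ delta0Set, X q 1 = 0 ∧ X q 2 = 0)
    (hv0 : ∀ q ∈ delta0Set, pdvPlusV X q 0 = 0)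
    (hharm : ∀ j, ∀ q ∈ DplusSet, tensionPlus g X j q = 0) (j : Fin 3) :
    ParityCompatible (sg j) (fun r => X r j) := by
  have hu1 := pduPlusV_eq_zero hX fun q hq => (haxis q hq).1
  have hu2 := pduPlusV_eq_zero hX fun q hq => (haxis q hq).2
  have hodd : ∀ k : Fin 3, sg k = -1 → (∀ q ∈ delta0Set, X q k = 0) →
      ParityCompatible (sg k) (fun r => X r k) := by
    intro k hs hk
    have hu : ∀ q ∈ delta0Set, pduPlus (fun r => X r k) q = 0 := pduPlusV_eq_zero hX hk
    have huu := pduPlus_eq_zero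
      (contDiffOn_pduPlus (m := 1) (contDiffOn_component hX k) (by norm_num)) hu
    have hvv : ∀ q ∈ delta0Set, pdvPlus (pdvPlus fun r => X r k) q = 0 := by
      intro q hq
      have hqP := delta0Set_subset_DplusSet hq
      have hG := Gamma_refl3 hsm hinv (hrange q hqP) k
      rw [refl3_eq_self (haxis q hq).1 (haxis q hq).2, hs] at hG
      have hG0 : ∀ a b, sg a * sg b = 1 → Gamma g k a b (X q) = 0 := fun a b hab => by
        have := hG a b
        rw [mul_assoc (-1 : ℝ), hab] at this
        linarith
      have := hharm k q hqP
      simp only [tensionPlus, Fin.sum_univ_three, hu1 q hq, hu2 q hq, hv0 q hq, huu q hq,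
        hG0 0 0 (by simp [sg]), hG0 1 1 (by simp [sg]), hG0 1 2 (by simp [sg]),
        hG0 2 1 (by simp [sg]), hG0 2 2 (by simp [sg])] at this
      simpa using this
    rw [hs]
    exact ⟨contDiffOn_component hX k, fun q hq => by simp [hk q hq], fun q hq => by simp [hu q hq],
      fun q _ => by simp, fun q hq => by simp [huu q hq], fun q _ => by simp,
      fun q hq => by simp [hvv q hq]⟩
  fin_cases j
  · have hvu := pduPlus_eq_zero
      (contDiffOn_pdvPlus (m := 1) (contDiffOn_component hX 0) (by norm_num)) hv0
    have hs : sg 0 = 1 := rfl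
    show ParityCompatible (sg 0) (fun r => X r 0)
    rw [hs]
    exact ⟨contDiffOn_component hX 0, fun q _ => by simp, fun q _ => by simp,
      fun q hq => by rw [show pdvPlus (fun r => X r 0) q = 0 from hv0 q hq, mul_zero],
      fun q _ => by simp, fun q hq => by rw [hvu q hq, mul_zero], fun q _ => by simp⟩
  · exact hodd 1 rfl fun q hq => (haxis q hq).1
  · exact hodd 2 rfl fun q hq => (haxis q hq).2

end HalfDisk

/-- **Reflection of a conformal harmonic (minimal) disk across a geodesic of reflection**:
let `g` be `I`-invariant on `U = (−ε,ε)³` and let `X : D⁺ → U` be `C²` up to `δ₀`, mapping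
`δ₀` into the axis `{x₂ = x₃ = 0}` with `∂_uX ≠ 0` on `δ₀ ∖ {0}`, conformal and harmonic
(with respect to `g`) on the open upper half-disk. Then the map `Z`, equal to `X` on `D⁺`
and to `I ∘ X ∘ (reflection)` on the lower half-disk, is `C²` on the whole disk `D` and is
conformal and harmonic on `D`. -/
theorem conformal_harmonic_reflection
    (ε : ℝ) (hε : 0 < ε) (g : Pt3 → Matrix (Fin 3) (Fin 3) ℝ)
    (hsm : SmoothMetric ε g) (hinv : IInvariant ε g)
    (X : ℝ × ℝ → Pt3)
    (hX2 : ContDiffOn ℝ 2 X DplusSet)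
    (hrange : ∀ q ∈ DplusSet, X q ∈ Ucube ε)
    (haxis : ∀ q ∈ delta0Set, X q 1 = 0 ∧ X q 2 = 0)
    (hne : ∀ t : ℝ, t ^ 2 < 1 → t ≠ 0 → deriv (fun s : ℝ => X (s, 0)) t ≠ 0)
    (hconf : ∀ q ∈ DupSet,
      gform g (X q) (pduV X q) (pduV X q) = gform g (X q) (pdvV X q) (pdvV X q) ∧
      gform g (X q) (pduV X q) (pdvV X q) = 0)
    (hharm : ∀ q ∈ DupSet, ∀ j : Fin 3, tension g X j q = 0)
    (Z : ℝ × ℝ → Pt3)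
    (hZ : ∀ q : ℝ × ℝ, Z q = if 0 ≤ q.2 then X q else refl3 (X (q.1, -q.2))) :
    ContDiffOn ℝ 2 Z DdiskSet ∧
    ∀ q ∈ DdiskSet,
      (gform g (Z q) (pduV Z q) (pduV Z q) = gform g (Z q) (pdvV Z q) (pdvV Z q) ∧
        gform g (Z q) (pduV Z q) (pdvV Z q) = 0) ∧
      ∀ j : Fin 3, tension g Z j q = 0 := by
  have hconfP := fun q hq => conformal_DplusSet hsm hX2 hrange hconf (q := q) hq
  have hharmP := tensionPlus_eq_zero hsm hX2 hrange hharm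
  have hcomp := parityCompatible_component hsm hinv hX2 hrange haxis
    (pdvPlusV_zero_eq_zero hsm hinv hX2 hrange haxis hne fun q hq => (hconfP q hq).2) hharmP
  have hZj : ∀ j, (fun r => Z r j) = parityExt (sg j) (fun r => X r j) := fun j => by
    ext r
    rw [hZ, parityExt]
    split_ifs <;> rfl
  have hZ2 : ContDiffOn ℝ 2 Z DdiskSet := contDiffOn_pi.2 fun j => by
    rw [hZj]
    exact (hcomp j).contDiffOn_parityExt
  refine ⟨hZ2, fun q hq => ?_⟩
  have hd : DifferentiableAt ℝ Z q :=
    (hZ2.contDiffAt (isOpen_DdiskSet.mem_nhds hq)).differentiableAt two_ne_zero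
  have hu : ∀ k, pduS (fun r => Z r k) q = parityExt (sg k) (pduPlus fun r => X r k) q :=
    fun k => by rw [hZj, (hcomp k).pduS_eq hq]
  have hv : ∀ k, pdvS (fun r => Z r k) q = parityExt (-sg k) (pdvPlus fun r => X r k) q :=
    fun k => by rw [hZj, (hcomp k).pdvS_eq hq]
  have huu : ∀ k, pduS (pduS fun r => Z r k) q =
      parityExt (sg k) (pduPlus (pduPlus fun r => X r k)) q :=
    fun k => by rw [hZj, (hcomp k).pduS_pduS_eq hq]
  have hvv : ∀ k, pdvS (pdvS fun r => Z r k) q =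
      parityExt (sg k) (pdvPlus (pdvPlus fun r => X r k)) q :=
    fun k => by rw [hZj, (hcomp k).pdvS_pdvS_eq hq]
  by_cases h : 0 ≤ q.2
  · have hqP : q ∈ DplusSet := ⟨hq, h⟩
    have hZq : Z q = X q := by rw [hZ, if_pos h]
    simp only [parityExt, if_pos h] at hu hv huu hvv
    have hU : pduV Z q = pduPlusV X q := funext fun k => (pduV_apply hd k).trans (hu k)
    have hV : pdvV Z q = pdvPlusV X q := funext fun k => (pdvV_apply hd k).trans (hv k)
    refine ⟨?_, fun j => ?_⟩
    · rw [hZq, hU, hV]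
      exact hconfP q hqP
    · rw [← hharmP j q hqP]
      simp only [tension, tensionPlus, hu, hv, huu, hvv, hZq, pduPlusV, pdvPlusV]
  · have hqP : (q.1, -q.2) ∈ DplusSet :=
      ⟨by simpa [DdiskSet] using hq, by simpa using (not_le.1 h).le⟩
    have hxU := hrange _ hqP
    have hZq : Z q = refl3 (X (q.1, -q.2)) := by rw [hZ, if_neg h]
    simp only [parityExt, if_neg h] at hu hv huu hvv
    have hU : pduV Z q = refl3 (pduPlusV X (q.1, -q.2)) :=
      funext fun k => (pduV_apply hd k).trans (hu k)
    have hV : pdvV Z q = refl3 (-pdvPlusV X (q.1, -q.2)) :=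
      funext fun k => (pdvV_apply hd k).trans ((hv k).trans (neg_mul_comm _ _))
    have hconfq := hconfP _ hqP
    refine ⟨?_, fun j => ?_⟩
    · rw [hZq, hU, hV, gform_refl3 hinv hxU, gform_refl3 hinv hxU, gform_refl3 hinv hxU]
      simpa [gform] using hconfq
    · have key : tension g Z j q = sg j * tensionPlus g X j (q.1, -q.2) := by
        simp only [tension, tensionPlus, hu, hv, huu, hvv, hZq, Gamma_refl3 hsm hinv hxU,
          mul_add (sg j), Finset.mul_sum]
        congr 1
        refine Finset.sum_congr rfl fun k _ => Finset.sum_congr rfl fun l _ => ?_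
        simp only [pduPlusV, pdvPlusV]
        linear_combination (sg j * Gamma g j k l (X (q.1, -q.2)) *
          (pduPlus (fun r => X r k) (q.1, -q.2) * pduPlus (fun r => X r l) (q.1, -q.2) +
            pdvPlus (fun r => X r k) (q.1, -q.2) * pdvPlus (fun r => X r l) (q.1, -q.2))) *
          (sg l * sg l * sg_mul_self k + sg_mul_self l)
      rw [key, hharmP j _ hqP, mul_zero]

end
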